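/- arXiv:2102.00597 — 2 statements merged into one kernel-verified Lean document; each statement's English description precedes it below -/
import Mathlib

section
/- Let C be a nontrivial linear code of length n over GF(q). If C⊥ is spanned as a GF(q)-vector space by its codewords of minimum weight d(C⊥), then C has minimum linear locality d(C⊥) − 1. -/
open scoped BigOperators

variable {F : Type*} [Field F] {ι : Type*} [Fintype ι]

/-- The Hamming weight of a word: the number of nonzero coordinates. -/
noncomputable def wt (c : ι → F) : ℕ := {i | c i ≠ 0}.ncard

/-- The minimum distance of a linear code: the least Hamming weight of a nonzero codeword. -/
noncomputable def minDist (C : Submodule F (ι → F)) : ℕ :=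
  sInf {w | ∃ c ∈ C, c ≠ 0 ∧ wt c = w}

/-- The dual code of a linear code. -/
def dualCode (C : Submodule F (ι → F)) : Submodule F (ι → F) where
  carrier := {x | ∀ c ∈ C, ∑ i, x i * c i = 0}
  add_mem' := by
    intro a b ha hb c hc
    have h1 := ha c hc
    have h2 := hb c hc
    simp only [Set.mem_setOf_eq, Pi.add_apply, add_mul, Finset.sum_add_distrib, h1, h2, add_zero]
  zero_mem' := by intro c hc; simp
  smul_mem' := by
    intro r a ha c hc
    have h := ha c hc
    simp only [Set.mem_setOf_eq, Pi.smul_apply, smul_eq_mul, mul_assoc, ← Finset.mul_sum, h,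
      mul_zero]

/-- `C` has linear locality `r`: every code symbol `c i` is a fixed linear combination of
at most `r` other code symbols. -/
def HasLinearLocality (C : Submodule F (ι → F)) (r : ℕ) : Prop :=
  ∀ i : ι, ∃ (R : Finset ι) (u : ι → F), i ∉ R ∧ R.card ≤ r ∧
    ∀ c ∈ C, c i = ∑ j ∈ R, u j * c j

omit [Fintype ι] in
theorem minDist_le_wt {C : Submodule F (ι → F)} {c : ι → F} (hc : c ∈ C) (h0 : c ≠ 0) :
    minDist C ≤ wt c :=
  Nat.sInf_le ⟨c, hc, h0, rfl⟩

omit [Fintype ι] in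
theorem wt_le_card {c : ι → F} {s : Finset ι} (h : ∀ i, c i ≠ 0 → i ∈ s) : wt c ≤ s.card := by
  rw [← Set.ncard_coe_finset s]
  exact Set.ncard_le_ncard (fun i hi => h i hi) s.finite_toSet

/-- A code of minimum distance at least two has, for every coordinate, a dual word that is
nonzero there. -/
theorem exists_mem_dualCode_apply_ne_zero {C : Submodule F (ι → F)} (h : 2 ≤ minDist C) (i : ι) :
    ∃ x ∈ dualCode C, x i ≠ 0 := by
  classical
  have hi : (Pi.single i 1 : ι → F) ∉ C := by
    intro hmem
    have hle := minDist_le_wt hmem (Pi.single_ne_zero_iff.2 one_ne_zero)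
    have hwt : wt (Pi.single i 1 : ι → F) ≤ ({i} : Finset ι).card :=
      wt_le_card fun j hj => by
        by_contra hne
        exact hj (Pi.single_eq_of_ne (by simpa using hne) _)
    rw [Finset.card_singleton] at hwt
    omega
  obtain ⟨f, hf, hC⟩ := Submodule.exists_le_ker_of_notMem hi
  refine ⟨fun j => f (Pi.single j 1), fun c hc => ?_, hf⟩
  have hfc : f c = 0 := hC hc
  rw [LinearMap.pi_apply_eq_sum_univ f c] at hfc
  rw [← hfc]
  refine Finset.sum_congr rfl fun j _ => ?_
  have hsingle : (Pi.single j 1 : ι → F) = fun k => if j = k then 1 else 0 := by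
    ext k
    simp [Pi.single_apply, eq_comm]
  simp only [smul_eq_mul, mul_comm, hsingle]

omit [Fintype ι] in
/-- If the words of a set `S` span a space containing a word that is nonzero at `i`, then some
word of `S` is nonzero at `i`. -/
theorem exists_apply_ne_zero_of_mem_span {S : Set (ι → F)} {x : ι → F} {i : ι}
    (hx : x ∈ Submodule.span F S) (hi : x i ≠ 0) : ∃ y ∈ S, y i ≠ 0 := by
  by_contra! h
  have hle : Submodule.span F S ≤ LinearMap.ker (LinearMap.proj i : (ι → F) →ₗ[F] F) :=
    Submodule.span_le.2 fun y hy => h y hy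
  exact hi (hle hx)

/-- A dual word that is nonzero at `i` expresses the `i`-th symbol through the other symbols in
its support. -/
theorem exists_recovery_of_mem_dualCode {C : Submodule F (ι → F)} {x : ι → F} {i : ι}
    (hx : x ∈ dualCode C) (hi : x i ≠ 0) :
    ∃ (R : Finset ι) (u : ι → F), i ∉ R ∧ R.card ≤ wt x - 1 ∧
      ∀ c ∈ C, c i = ∑ j ∈ R, u j * c j := by
  classical
  have hmem : i ∈ Finset.univ.filter fun j => x j ≠ 0 := by simpa using hi
  refine ⟨(Finset.univ.filter fun j => x j ≠ 0).erase i, fun j => -((x i)⁻¹ * x j),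
    Finset.notMem_erase _ _, ?_, fun c hc => ?_⟩
  · rw [Finset.card_erase_of_mem hmem, wt, ← Set.ncard_coe_finset]
    simp
  · have hsum : ∑ j ∈ Finset.univ.filter (fun j => x j ≠ 0), x j * c j = 0 := by
      refine (Finset.sum_subset (Finset.subset_univ _) fun j _ hj => ?_).trans (hx c hc)
      rw [Finset.mem_filter_univ, not_not] at hj
      rw [hj, zero_mul]
    rw [← Finset.add_sum_erase _ _ hmem] at hsum
    simp only [neg_mul, mul_assoc, Finset.sum_neg_distrib, ← Finset.mul_sum]
    rw [eq_neg_of_add_eq_zero_right hsum]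
    field_simp

/-- Linear locality `r` bounds the minimum distance of the dual code by `r + 1`. -/
theorem HasLinearLocality.minDist_dualCode_le [Nonempty ι] {C : Submodule F (ι → F)} {r : ℕ}
    (h : HasLinearLocality C r) : minDist (dualCode C) ≤ r + 1 := by
  classical
  obtain ⟨i⟩ := ‹Nonempty ι›
  obtain ⟨R, u, hiR, hR, hrec⟩ := h i
  let x : ι → F := fun j => (if j = i then 1 else 0) - if j ∈ R then u j else 0
  have hx : x ∈ dualCode C := fun c hc => by
    simp [x, sub_mul, ite_mul, Finset.sum_sub_distrib, ← hrec c hc]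
  have hx0 : x ≠ 0 := fun h0 => by simpa [x, hiR] using congrFun h0 i
  calc minDist (dualCode C) ≤ wt x := minDist_le_wt hx hx0
    _ ≤ (insert i R).card := wt_le_card fun j hj => by
      by_contra hne
      rw [Finset.mem_insert, not_or] at hne
      exact hj (by simp [x, hne.1, hne.2])
    _ ≤ r + 1 := by
      rw [Finset.card_insert_of_notMem hiR]
      omega

/-- If `C⊥` is spanned by its minimum-weight codewords, then the nontrivial
code `C` has minimum linear locality `d(C⊥) - 1`. -/
theorem statement5 (C : Submodule F (ι → F))
    (h1 : 2 ≤ minDist C) (h2 : 2 ≤ minDist (dualCode C))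
    (hspan : Submodule.span F {c : ι → F | c ∈ dualCode C ∧ wt c = minDist (dualCode C)}
      = dualCode C) :
    IsLeast {r : ℕ | HasLinearLocality C r} (minDist (dualCode C) - 1) := by
  constructor
  · intro i
    obtain ⟨x, hx, hxi⟩ := exists_mem_dualCode_apply_ne_zero h1 i
    rw [← hspan] at hx
    obtain ⟨y, ⟨hy, hwt⟩, hyi⟩ := exists_apply_ne_zero_of_mem_span hx hxi
    rw [← hwt]
    exact exists_recovery_of_mem_dualCode hy hyi
  · intro r hr
    have : Nonempty ι := by
      by_contra hempty
      rw [not_nonempty_iff] at hempty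
      have hzero : minDist C = 0 :=
        Nat.sInf_eq_zero.2 <| Or.inr <| Set.eq_empty_of_forall_notMem
          fun _ ⟨_, _, hc, _⟩ => hc (Subsingleton.elim _ _)
      omega
    have := HasLinearLocality.minDist_dualCode_le hr
    omega
end

section
/- Let q = 2^m with m ≥ 3, let h = 2^i with 2 ≤ i < m, and let n = hq + h − q. Let a_1, ..., a_n be nonzero vectors in GF(q)^3, no two of which are proportional, such that every 2-dimensional linear subspace of GF(q)^3 contains either exactly 0 or exactly h of the vectors a_1, ..., a_n (i.e., {a_1,...,a_n} is a maximal (n, h)-arc in PG(2, GF(q))). Let C(A) = {(v·a_1, v·a_2, ..., v·a_n) : v ∈ GF(q)^3}, where v·a denotes the standard dot product. Then C(A) is an [n, 3, n − h] code with minimum linear locality 2, and its dual C(A)⊥ is an [n, n − 3, 3] code with minimum linear locality n − h − 1. -/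
open scoped BigOperators

variable {F : Type*} [Field F] {ι : Type*} [Fintype ι]

/-- The linear code generated by the matrix whose `i`-th column is `a i`: the codewords are
`(v · a i)ᵢ` for `v` ranging over `GF(q)^κ`. -/
def genMatCode {κ : Type*} [Fintype κ] (a : ι → κ → F) : Submodule F (ι → F) where
  carrier := {c | ∃ v : κ → F, ∀ i, c i = ∑ j, v j * a i j}
  add_mem' := by
    rintro x y ⟨v, hv⟩ ⟨w, hw⟩
    exact ⟨v + w, fun i => by simp [hv i, hw i, add_mul, Finset.sum_add_distrib]⟩
  zero_mem' := ⟨0, fun i => by simp⟩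
  smul_mem' := by
    rintro r x ⟨v, hv⟩
    exact ⟨r • v, fun i => by simp [hv i, Finset.mul_sum, mul_assoc]⟩

lemma dualCode_dualCode (C : Submodule F (ι → F)) : dualCode (dualCode C) = C := by
  classical
  refine le_antisymm (fun c hc => ?_) fun c hc x hx => ?_
  · by_contra hcC
    obtain ⟨f, hfc, hf⟩ := Submodule.exists_le_ker_of_notMem hcC
    have key (x : ι → F) : f x = ∑ i, x i * f fun j => if i = j then 1 else 0 :=
      LinearMap.pi_apply_eq_sum_univ f x
    refine hfc ((key c).trans (hc _ fun x hx => ?_))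
    refine Eq.trans ?_ ((key x).symm.trans (LinearMap.mem_ker.1 (hf hx)))
    exact Finset.sum_congr rfl fun i _ => mul_comm _ _
  · rw [← hx c hc]
    exact Finset.sum_congr rfl fun i _ => mul_comm _ _

/-- A code has locality `r` iff every coordinate is covered by a dual word of weight at most
`r + 1`. -/
lemma hasLinearLocality_iff (C : Submodule F (ι → F)) (r : ℕ) :
    HasLinearLocality C r ↔ ∀ i, ∃ x ∈ dualCode C, x i ≠ 0 ∧ wt x ≤ r + 1 := by
  classical
  refine forall_congr' fun i => ⟨?_, ?_⟩
  · rintro ⟨R, u, hi, hR, hu⟩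
    refine ⟨Pi.single i 1 - fun j => if j ∈ R then u j else 0, fun c hc => ?_, ?_, ?_⟩
    · simp [sub_mul, Finset.sum_sub_distrib, Pi.single_apply, ← hu c hc]
    · simp [hi]
    · have hsub : {j | (Pi.single i 1 - fun j => if j ∈ R then u j else 0 : ι → F) j ≠ 0} ⊆
          ((insert i R : Finset ι) : Set ι) := by
        intro j hj
        by_contra hjR
        rw [Finset.mem_coe, Finset.mem_insert, not_or] at hjR
        exact hj (by simp [hjR.1, hjR.2])
      have hle := Set.ncard_le_ncard hsub
      rw [Set.ncard_coe_finset, Finset.card_insert_of_notMem hi] at hle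
      exact hle.trans (by omega)
  · rintro ⟨x, hx, hxi, hwt⟩
    have hwt' : wt x = (Finset.univ.filter fun j => x j ≠ 0).card := by
      rw [wt, ← Set.ncard_coe_finset]
      simp
    refine ⟨(Finset.univ.filter fun j => x j ≠ 0).erase i, fun j => -(x j / x i), by simp, ?_,
      fun c hc => ?_⟩
    · rw [Finset.card_erase_of_mem (by simpa using hxi)]
      omega
    · have hsum : ∑ j ∈ Finset.univ.filter (fun j => x j ≠ 0), x j * c j = 0 := by
        refine (Finset.sum_subset (Finset.subset_univ _) fun j _ hj => ?_).trans (hx c hc)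
        rw [show x j = 0 by simpa using hj, zero_mul]
      rw [← Finset.add_sum_erase _ _ (by simpa using hxi : i ∈ _)] at hsum
      have hrw : ∑ j ∈ (Finset.univ.filter fun j => x j ≠ 0).erase i, -(x j / x i) * c j =
          -(x i)⁻¹ * ∑ j ∈ (Finset.univ.filter fun j => x j ≠ 0).erase i, x j * c j := by
        rw [Finset.mul_sum]
        exact Finset.sum_congr rfl fun j _ => by ring
      rw [hrw, eq_neg_of_add_eq_zero_right hsum]
      field_simp

/-- If the minimum weight words of the dual code cover all coordinates, then they determine the
minimum locality. -/
lemma isLeast_hasLinearLocality [Nonempty ι] {C : Submodule F (ι → F)} {d : ℕ}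
    (hmin : ∀ x ∈ dualCode C, x ≠ 0 → d ≤ wt x)
    (hcov : ∀ i, ∃ x ∈ dualCode C, x i ≠ 0 ∧ wt x ≤ d) :
    IsLeast {r | HasLinearLocality C r} (d - 1) := by
  refine ⟨(hasLinearLocality_iff C _).2 fun i => ?_, fun r hr => ?_⟩
  · obtain ⟨x, hx, hxi, hwt⟩ := hcov i
    exact ⟨x, hx, hxi, hwt.trans (by omega)⟩
  · obtain ⟨x, hx, hxi, hwt⟩ := (hasLinearLocality_iff C r).1 hr (Classical.arbitrary ι)
    have := hmin x hx fun h => hxi (by simp [h])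
    omega

lemma minDist_eq {α : Type*} [Nonempty α] {C : Submodule F (α → F)} {d : ℕ}
    (hmin : ∀ x ∈ C, x ≠ 0 → d ≤ wt x) (hcov : ∀ i, ∃ x ∈ C, x i ≠ 0 ∧ wt x ≤ d) :
    minDist C = d := by
  obtain ⟨x, hx, hxi, hwt⟩ := hcov (Classical.arbitrary α)
  have hx0 : x ≠ 0 := fun h => hxi (by simp [h])
  refine IsLeast.csInf_eq ⟨⟨x, hx, hx0, hwt.antisymm (hmin x hx hx0)⟩, ?_⟩
  rintro _ ⟨y, hy, hy0, rfl⟩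
  exact hmin y hy hy0

section genMatCode

variable {κ : Type*} [Fintype κ]

lemma mem_genMatCode_iff {α : Type*} {a : α → κ → F} {c : α → F} :
    c ∈ genMatCode a ↔ ∃ f : Module.Dual F (κ → F), ∀ i, c i = f (a i) := by
  classical
  constructor
  · rintro ⟨v, hv⟩
    exact ⟨Fintype.linearCombination F v, fun i => by
      simp [hv, Fintype.linearCombination_apply, mul_comm]⟩
  · rintro ⟨f, hf⟩
    refine ⟨fun j => f fun k => if j = k then 1 else 0, fun i => ?_⟩
    rw [hf, LinearMap.pi_apply_eq_sum_univ f]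
    exact Finset.sum_congr rfl fun j _ => mul_comm _ _

lemma finrank_genMatCode (a : ι → κ → F) :
    Module.finrank F (genMatCode a) = Module.finrank F (Submodule.span F (Set.range a)) := by
  have h : genMatCode a = LinearMap.range (Matrix.mulVecLin (Matrix.of a)) := by
    ext c
    simp only [LinearMap.mem_range, Matrix.mulVecLin_apply, funext_iff, Matrix.mulVec, dotProduct,
      Matrix.of_apply]
    exact exists_congr fun v => forall_congr' fun i => by simp only [mul_comm, eq_comm]
  rw [h]
  exact Matrix.rank_eq_finrank_span_row (Matrix.of a)

lemma dualCode_genMatCode (a : ι → κ → F) :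
    dualCode (genMatCode a) = LinearMap.ker (Fintype.linearCombination F a) := by
  classical
  ext x
  rw [LinearMap.mem_ker, Fintype.linearCombination_apply]
  constructor
  · intro hx
    ext j
    simpa using hx (fun i => a i j) ⟨Pi.single j 1, fun i => by simp [Pi.single_apply]⟩
  · intro hx c hc
    obtain ⟨f, hf⟩ := mem_genMatCode_iff.1 hc
    simpa [hf] using congrArg f hx

lemma finrank_dualCode_genMatCode (a : ι → κ → F) :
    Module.finrank F (dualCode (genMatCode a)) =
      Fintype.card ι - Module.finrank F (Submodule.span F (Set.range a)) := by
  have h := LinearMap.finrank_range_add_finrank_ker (Fintype.linearCombination F a)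
  rw [Fintype.range_linearCombination, Module.finrank_fintype_fun_eq_card] at h
  rw [dualCode_genMatCode]
  omega

/-- The dual code of pairwise non-proportional nonzero columns has minimum weight at least `3`. -/
lemma three_le_wt_of_mem_dualCode {a : ι → κ → F} (ha0 : ∀ j, a j ≠ 0)
    (hprop : ∀ j k, j ≠ k → ∀ lam : F, a j ≠ lam • a k) {x : ι → F}
    (hx : x ∈ dualCode (genMatCode a)) (hx0 : x ≠ 0) : 3 ≤ wt x := by
  classical
  rw [dualCode_genMatCode, LinearMap.mem_ker, Fintype.linearCombination_apply] at hx
  set S := Finset.univ.filter fun j => x j ≠ 0 with hS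
  have hmem {j} : j ∈ S ↔ x j ≠ 0 := by simp [hS]
  have hwt : wt x = S.card := by
    rw [wt, ← Set.ncard_coe_finset]
    simp [hS]
  have hsum : ∑ j ∈ S, x j • a j = 0 := by
    rw [← hx]
    refine Finset.sum_subset (Finset.subset_univ _) fun j _ hj => ?_
    rw [not_not.1 (hmem.not.1 hj), zero_smul]
  by_contra! hlt
  have hcases : S.card = 0 ∨ S.card = 1 ∨ S.card = 2 := by omega
  rcases hcases with h | h | h
  · refine hx0 (funext fun j => ?_)
    by_contra hj
    simpa [Finset.card_eq_zero.1 h] using hmem.2 hj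
  · obtain ⟨j, hj⟩ := Finset.card_eq_one.1 h
    rw [hj, Finset.sum_singleton] at hsum
    exact (smul_ne_zero (hmem.1 (by simp [hj])) (ha0 j)) hsum
  · obtain ⟨j, k, hjk, hjkS⟩ := Finset.card_eq_two.1 h
    rw [hjkS, Finset.sum_pair hjk] at hsum
    have hj : x j ≠ 0 := hmem.1 (by simp [hjkS])
    refine hprop j k hjk (-((x j)⁻¹ * x k)) ?_
    rw [neg_smul, mul_smul, ← smul_neg, ← eq_neg_of_add_eq_zero_left hsum, inv_smul_smul₀ hj]

end genMatCode

section Vectors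

variable {V : Type*} [AddCommGroup V] [Module F V]

/-- The weight of the word of values of a functional on a family of vectors is the number of
vectors off the corresponding hyperplane. -/
lemma wt_dual_apply (a : ι → V) (f : Module.Dual F V) :
    wt (fun i => f (a i)) = Fintype.card ι - {j | a j ∈ LinearMap.ker f}.ncard := by
  have h := Set.ncard_add_ncard_compl {j | a j ∈ LinearMap.ker f}
  rw [Nat.card_eq_fintype_card] at h
  rw [← h, Nat.add_sub_cancel_left]
  rfl

lemma finrank_span_pair_eq_two {x y : V} (hx : x ≠ 0) (hxy : ∀ s : F, y ≠ s • x) :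
    Module.finrank F (Submodule.span F {x, y}) = 2 := by
  have hli : LinearIndependent F ![x, y] :=
    (LinearIndependent.pair_iff' hx).2 fun s hs => hxy s hs.symm
  rw [← Matrix.range_cons_cons_empty x y ![], finrank_span_eq_card hli, Fintype.card_fin]

end Vectors

/-- Let `q = 2^m` (`m ≥ 3`), `h = 2^i` (`2 ≤ i < m`), `n = hq + h - q`, and
let `a 1, ..., a n` be pairwise non-proportional nonzero vectors of `GF(q)^3` such that every
`2`-dimensional subspace of `GF(q)^3` contains exactly `0` or exactly `h` of them (a maximal
`(n, h)`-arc). Then the maximal arc code `C(A)` is an `[n, 3, n - h]` code with minimum linear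
locality `2`, and its dual is an `[n, n-3, 3]` code with minimum linear locality `n - h - 1`. -/
theorem statement13 {F : Type*} [Field F] [Fintype F] (q m h i n : ℕ)
    (hq : Fintype.card F = q) (hqm : q = 2 ^ m) (hm : 3 ≤ m)
    (hh : h = 2 ^ i) (hi2 : 2 ≤ i) (him : i < m)
    (hn : n = h * q + h - q)
    (a : Fin n → Fin 3 → F)
    (ha0 : ∀ j, a j ≠ 0)
    (hprop : ∀ j k : Fin n, j ≠ k → ∀ lam : F, a j ≠ lam • a k)
    (harc : ∀ W : Submodule F (Fin 3 → F), Module.finrank F W = 2 →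
      {j | a j ∈ W}.ncard = 0 ∨ {j | a j ∈ W}.ncard = h) :
    Module.finrank F (genMatCode a) = 3 ∧
    minDist (genMatCode a) = n - h ∧
    IsLeast {r : ℕ | HasLinearLocality (genMatCode a) r} 2 ∧
    Module.finrank F (dualCode (genMatCode a)) = n - 3 ∧
    minDist (dualCode (genMatCode a)) = 3 ∧
    IsLeast {r : ℕ | HasLinearLocality (dualCode (genMatCode a)) r} (n - h - 1) := by
  have hq8 : 8 ≤ q := hqm ▸ (Nat.pow_le_pow_right two_pos hm : 2 ^ 3 ≤ 2 ^ m)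
  have hh4 : 4 ≤ h := hh ▸ (Nat.pow_le_pow_right two_pos hi2 : 2 ^ 2 ≤ 2 ^ i)
  have hhn : h < n := by
    have : 4 * q ≤ h * q := Nat.mul_le_mul_right q hh4
    omega
  have : Nonempty (Fin n) := ⟨⟨0, by omega⟩⟩
  have : Nontrivial (Fin n) := Fin.nontrivial_iff_two_le.2 (by omega)
  have hline {W : Submodule F (Fin 3 → F)} (hW : Module.finrank F W = 2) {j} (hj : a j ∈ W) :
      {j | a j ∈ W}.ncard = h :=
    (harc W hW).resolve_left ((Set.ncard_pos).2 ⟨j, hj⟩).ne'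
  have hker {f : Module.Dual F (Fin 3 → F)} (hf : f ≠ 0) :
      Module.finrank F (LinearMap.ker f) = 2 := by
    have := Module.Dual.finrank_ker_add_one_of_ne_zero hf
    rw [Module.finrank_fin_fun] at this
    omega
  have hpair {j k} (hjk : j ≠ k) := finrank_span_pair_eq_two (ha0 j) (hprop k j hjk.symm)
  have hspan : Submodule.span F (Set.range a) = ⊤ := by
    by_contra hne
    obtain ⟨f, hf, hle⟩ := Submodule.exists_le_ker_of_lt_top _ (lt_top_iff_ne_top.2 hne)
    have hmem (j) : a j ∈ LinearMap.ker f := hle (Submodule.subset_span ⟨j, rfl⟩)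
    have hcard := hline (hker hf) (hmem (Classical.arbitrary _))
    simp only [hmem, Set.ofPred_true, Set.ncard_univ, Nat.card_fin] at hcard
    omega
  have hfin : Module.finrank F (Submodule.span F (Set.range a)) = 3 := by
    rw [hspan, finrank_top, Module.finrank_fin_fun]
  have hmin : ∀ c ∈ genMatCode a, c ≠ 0 → n - h ≤ wt c := by
    intro c hc hc0
    obtain ⟨f, hf⟩ := mem_genMatCode_iff.1 hc
    obtain rfl : c = fun i => f (a i) := funext hf
    have hf0 : f ≠ 0 := by
      rintro rfl
      exact hc0 rfl
    rw [wt_dual_apply, Fintype.card_fin]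
    rcases harc _ (hker hf0) with h' | h' <;> omega
  have hcov : ∀ j, ∃ c ∈ genMatCode a, c j ≠ 0 ∧ wt c ≤ n - h := by
    intro j
    obtain ⟨k, hk⟩ := exists_ne j
    obtain ⟨l, hl⟩ : ∃ l, a l ∉ Submodule.span F {a j, a k} := by
      by_contra! hall
      have hcard := hline (hpair hk.symm) (hall j)
      simp only [hall, Set.ofPred_true, Set.ncard_univ, Nat.card_fin] at hcard
      omega
    have hlk : l ≠ k := by
      rintro rfl
      exact hl (Submodule.subset_span (by simp))
    have hj : a j ∉ Submodule.span F {a l, a k} := by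
      intro hj
      obtain ⟨s, t, hst⟩ := Submodule.mem_span_pair.1 hj
      have hs : s ≠ 0 := by
        rintro rfl
        exact hprop j k hk.symm t (by simp [← hst])
      refine hl (Submodule.mem_span_pair.2 ⟨s⁻¹, -(s⁻¹ * t), ?_⟩)
      rw [← hst, smul_add, inv_smul_smul₀ hs, neg_smul, mul_smul, add_neg_cancel_right]
    obtain ⟨f, hfj, hf⟩ := Submodule.exists_le_ker_of_notMem hj
    have hf0 : f ≠ 0 := by
      rintro rfl
      exact hfj rfl
    refine ⟨fun i => f (a i), mem_genMatCode_iff.2 ⟨f, fun _ => rfl⟩, hfj, ?_⟩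
    rw [wt_dual_apply, Fintype.card_fin,
      hline (hker hf0) (hf (Submodule.subset_span (by simp : a l ∈ _)))]
  have hdmin : ∀ x ∈ dualCode (genMatCode a), x ≠ 0 → 3 ≤ wt x :=
    fun x hx hx0 => three_le_wt_of_mem_dualCode ha0 hprop hx hx0
  have hdcov : ∀ j, ∃ x ∈ dualCode (genMatCode a), x j ≠ 0 ∧ wt x ≤ 3 := by
    intro j
    obtain ⟨k, hk⟩ := exists_ne j
    have hcard := hline (hpair hk.symm) (Submodule.subset_span (by simp) : a j ∈ _)
    obtain ⟨l, hl, hljk⟩ : ∃ l ∈ {l | a l ∈ Submodule.span F {a j, a k}},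
        l ∉ ({j, k} : Set (Fin n)) := by
      refine Set.exists_mem_notMem_of_ncard_lt_ncard ?_
      rw [hcard, Set.ncard_pair hk.symm]
      omega
    simp only [Set.mem_insert_iff, Set.mem_singleton_iff, not_or] at hljk
    obtain ⟨s, t, hst⟩ := Submodule.mem_span_pair.1 hl
    have hs : s ≠ 0 := by
      rintro rfl
      exact hprop l k hljk.2 t (by simp [← hst])
    refine ⟨Pi.single j s + Pi.single k t - Pi.single l 1, ?_, ?_, ?_⟩
    · rw [dualCode_genMatCode, LinearMap.mem_ker]
      simp [Fintype.linearCombination_apply_single, hst]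
    · simp [hk.symm, Ne.symm hljk.1, hs]
    · refine (Set.ncard_le_ncard (t := (({j, k, l} : Finset (Fin n)) : Set (Fin n))) ?_).trans ?_
      · intro y hy
        by_contra hyn
        simp only [Finset.coe_insert, Finset.coe_singleton, Set.mem_insert_iff,
          Set.mem_singleton_iff, not_or] at hyn
        exact hy (by simp [hyn.1, hyn.2.1, hyn.2.2])
      · rw [Set.ncard_coe_finset]
        exact Finset.card_le_three
  refine ⟨by rw [finrank_genMatCode, hfin], minDist_eq hmin hcov,
    isLeast_hasLinearLocality hdmin hdcov, ?_, minDist_eq hdmin hdcov, ?_⟩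
  · rw [finrank_dualCode_genMatCode, hfin, Fintype.card_fin]
  · exact isLeast_hasLinearLocality (by rwa [dualCode_dualCode]) (by rwa [dualCode_dualCode])
end
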